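/- Let d ≥ 2 be an integer, α ∈ (0,2), and R ∈ (0,1]. Then the normalized expected occupation measure μ = κ_{d,α}^{-1} V_1(0,dy) of the ball B(0,R) is given by ∫_{B(0,R)} κ_{d,α}^{-1} · 2^{-α} π^{-d/2} (Γ(d/2)/Γ(α/2)^2) B(d/2-α/2, α/2) |y|^{α-d} (1 - I(|y|^2; d/2-α/2, α/2)) dy = I(R^2; d/2, α/2) + R^α · (B(d/2-α/2, α/2)/B(d/2, α/2)) · (1 - I(R^2; d/2-α/2, α/2)), where κ_{d,α} = (2^{1-α}/α) · Γ(d/2)/(Γ(α/2) Γ(d/2+α/2)). -/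

import Mathlib

open Real MeasureTheory

/-- Beta function B(z,w) = Γ(z)Γ(w)/Γ(z+w). -/
noncomputable def betaFn (z w : ℝ) : ℝ :=
  Real.Gamma z * Real.Gamma w / Real.Gamma (z + w)

/-- Regularized incomplete Beta function I(x; z, w). -/
noncomputable def regIncBeta (x z w : ℝ) : ℝ :=
  (∫ u in (0:ℝ)..x, u ^ (z - 1) * (1 - u) ^ (w - 1)) / betaFn z w

/-- κ_{d,α} = (2^{1-α}/α) · Γ(d/2)/(Γ(α/2) Γ(d/2+α/2)). -/
noncomputable def kappa (d : ℕ) (α : ℝ) : ℝ :=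
  (2:ℝ) ^ (1 - α) / α * (Real.Gamma ((d:ℝ)/2) / (Real.Gamma (α/2) * Real.Gamma ((d:ℝ)/2 + α/2)))

lemma betaFn_pos {z w : ℝ} (hz : 0 < z) (hw : 0 < w) : 0 < betaFn z w :=
  div_pos (mul_pos (Real.Gamma_pos_of_pos hz) (Real.Gamma_pos_of_pos hw))
    (Real.Gamma_pos_of_pos (add_pos hz hw))

lemma intervalIntegrable_beta {z w : ℝ} (hz : 0 < z) (hw : 0 < w) :
    IntervalIntegrable (fun u : ℝ => u ^ (z - 1) * (1 - u) ^ (w - 1)) volume 0 1 := by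
  have h := (Complex.betaIntegral_convergent (u := z) (v := w) (by simpa) (by simpa)).norm
  refine h.congr_uIoo fun x hx => ?_
  rw [Set.uIoo_of_le zero_le_one] at hx
  have h1 : ((x : ℂ)) ^ ((z : ℂ) - 1) = ((x ^ (z - 1) : ℝ) : ℂ) := by
    rw [Complex.ofReal_cpow hx.1.le]; push_cast; rfl
  have h2 : (1 - (x : ℂ)) ^ ((w : ℂ) - 1) = (((1 - x) ^ (w - 1) : ℝ) : ℂ) := by
    rw [Complex.ofReal_cpow (sub_nonneg.2 hx.2.le)]; push_cast; rfl
  have h3 : 0 ≤ x ^ (z - 1) * (1 - x) ^ (w - 1) :=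
    mul_nonneg (rpow_nonneg hx.1.le _) (rpow_nonneg (sub_nonneg.2 hx.2.le) _)
  simp only [h1, h2, ← Complex.ofReal_mul, Complex.norm_real, Real.norm_of_nonneg h3]

lemma continuousOn_regIncBeta {z w : ℝ} (hz : 0 < z) (hw : 0 < w) :
    ContinuousOn (fun x => regIncBeta x z w) (Set.Icc 0 1) := by
  have h := intervalIntegral.continuousOn_primitive_interval' (intervalIntegrable_beta hz hw)
    Set.left_mem_uIcc
  rw [Set.uIcc_of_le zero_le_one] at h
  exact h.div_const _

lemma hasDerivAt_regIncBeta {z w x : ℝ} (hz : 0 < z) (hw : 0 < w) (hx : x ∈ Set.Ioo (0 : ℝ) 1) :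
    HasDerivAt (fun x => regIncBeta x z w)
      (x ^ (z - 1) * (1 - x) ^ (w - 1) / betaFn z w) x := by
  refine HasDerivAt.div_const ?_ _
  apply intervalIntegral.integral_hasDerivAt_right
  · refine (intervalIntegrable_beta hz hw).mono_set ?_
    rw [Set.uIcc_of_le zero_le_one, Set.uIcc_of_le hx.1.le]
    exact Set.Icc_subset_Icc_right hx.2.le
  · exact (Measurable.stronglyMeasurable (by fun_prop)).stronglyMeasurableAtFilter
  · exact (continuousAt_id.rpow_const (Or.inl hx.1.ne')).mul
      ((continuousAt_const.sub continuousAt_id).rpow_const (Or.inl (sub_pos.2 hx.2).ne'))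

lemma regIncBeta_zero (z w : ℝ) : regIncBeta 0 z w = 0 := by
  simp [regIncBeta]

lemma integral_rpow_mul_one_sub_regIncBeta {z w c R : ℝ} (hz : 0 < z) (hw : 0 < w) (hc : 0 < c)
    (hR : R ∈ Set.Ioc (0 : ℝ) 1) :
    ∫ r in (0 : ℝ)..R, 2 * c * r ^ (2 * c - 1) * (1 - regIncBeta (r ^ 2) z w)
      = R ^ (2 * c) * (1 - regIncBeta (R ^ 2) z w)
        + betaFn (z + c) w / betaFn z w * regIncBeta (R ^ 2) (z + c) w := by
  have hsq : Set.MapsTo (fun r : ℝ => r ^ 2) (Set.Icc 0 R) (Set.Icc 0 1) := fun r hr =>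
    ⟨sq_nonneg r, pow_le_one₀ hr.1 (hr.2.trans hR.2)⟩
  have hcont {z : ℝ} (hz : 0 < z) :
      ContinuousOn (fun r : ℝ => regIncBeta (r ^ 2) z w) (Set.Icc 0 R) :=
    (continuousOn_regIncBeta hz hw).comp (by fun_prop) hsq
  have hB := (betaFn_pos hz hw).ne'
  have hB' := (betaFn_pos (add_pos hz hc) hw).ne'
  rw [intervalIntegral.integral_eq_sub_of_hasDerivAt_of_le
    (f := fun r => r ^ (2 * c) * (1 - regIncBeta (r ^ 2) z w)
        + betaFn (z + c) w / betaFn z w * regIncBeta (r ^ 2) (z + c) w) hR.1.le]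
  · simp [regIncBeta_zero, Real.zero_rpow (mul_pos two_pos hc).ne']
  · refine ContinuousOn.add (ContinuousOn.mul ?_ (continuousOn_const.sub (hcont hz)))
      (continuousOn_const.mul (hcont (add_pos hz hc)))
    exact continuousOn_id.rpow_const fun _ _ => Or.inr (by positivity)
  · intro r hr
    have hr2 : r ^ 2 ∈ Set.Ioo (0 : ℝ) 1 :=
      ⟨pow_pos hr.1 2, pow_lt_one₀ hr.1.le (hr.2.trans_le hR.2) two_ne_zero⟩
    have hd {z : ℝ} (hz : 0 < z) :=
      HasDerivAt.comp (h := fun r : ℝ => r ^ 2) r (hasDerivAt_regIncBeta hz hw hr2)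
        (hasDerivAt_pow 2 r)
    have key := ((Real.hasDerivAt_rpow_const (p := 2 * c) (Or.inl hr.1.ne')).mul
      ((hd hz).const_sub 1)).add
      ((hd (add_pos hz hc)).const_mul (betaFn (z + c) w / betaFn z w))
    have hp : (r ^ 2) ^ (z + c - 1) = (r ^ 2) ^ (z - 1) * r ^ (2 * c) := by
      rw [add_sub_right_comm, Real.rpow_add hr2.1, ← Real.rpow_natCast r 2, ← Real.rpow_mul hr.1.le,
        ← Real.rpow_mul hr.1.le, Nat.cast_ofNat]
    refine key.congr_deriv ?_
    simp only [Function.comp, hp]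
    field_simp
    ring
  · refine IntervalIntegrable.mul_continuousOn ?_ ?_
    · exact (intervalIntegral.intervalIntegrable_rpow' (by linarith)).const_mul _
    · rw [Set.uIcc_of_le hR.1.le]
      exact continuousOn_const.sub (hcont hz)

lemma setIntegral_ball_fun_norm {d : ℕ} (hd : 0 < d) {R : ℝ} (hR : 0 ≤ R) (f : ℝ → ℝ) :
    ∫ y in Metric.ball (0 : EuclideanSpace ℝ (Fin d)) R, f ‖y‖
      = 2 * π ^ ((d : ℝ) / 2) / Real.Gamma ((d : ℝ) / 2)
        * ∫ r in (0 : ℝ)..R, r ^ (d - 1) * f r := by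
  have : Nonempty (Fin d) := ⟨⟨0, hd⟩⟩
  have hd' : (0 : ℝ) < d := by exact_mod_cast hd
  have hG := Real.Gamma_pos_of_pos (half_pos hd')
  have hball : (volume : Measure (EuclideanSpace ℝ (Fin d))).real (Metric.ball 0 1)
      = π ^ ((d : ℝ) / 2) / ((d : ℝ) / 2 * Real.Gamma ((d : ℝ) / 2)) := by
    rw [Measure.real, EuclideanSpace.volume_ball, Fintype.card_fin,
      Real.Gamma_add_one (half_pos hd').ne', ENNReal.ofReal_one, one_pow, one_mul,
      ENNReal.toReal_ofReal (by positivity), Real.sqrt_eq_rpow, ← Real.rpow_natCast,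
      ← Real.rpow_mul pi_pos.le, one_div_mul_eq_div]
  have hind : ∫ y in Metric.ball (0 : EuclideanSpace ℝ (Fin d)) R, f ‖y‖
      = ∫ y : EuclideanSpace ℝ (Fin d), (Set.Iio R).indicator f ‖y‖ := by
    rw [← integral_indicator Metric.isOpen_ball.measurableSet]
    congr 1 with y
    simp [Set.indicator]
  rw [hind, integral_fun_norm_addHaar, hball, finrank_euclideanSpace, Fintype.card_fin,
    intervalIntegral.integral_of_le hR, integral_Ioc_eq_integral_Ioo]
  have h1 : ∫ r in Set.Ioi (0 : ℝ), r ^ (d - 1) • (Set.Iio R).indicator f r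
      = ∫ r in Set.Ioo (0 : ℝ) R, r ^ (d - 1) * f r := by
    rw [← Set.Ioi_inter_Iio, ← setIntegral_indicator measurableSet_Iio]
    congr 1 with r
    simp [Set.indicator]
  rw [h1, nsmul_eq_mul, smul_eq_mul]
  field_simp

theorem stmt12 (d : ℕ) (hd : 2 ≤ d) (α : ℝ) (hα : α ∈ Set.Ioo (0:ℝ) 2)
    (R : ℝ) (hR : R ∈ Set.Ioc (0:ℝ) 1) :
    (∫ y in Metric.ball (0 : EuclideanSpace ℝ (Fin d)) R,
        (kappa d α)⁻¹ * ((2:ℝ) ^ (-α) * Real.pi ^ (-(d:ℝ)/2)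
          * (Real.Gamma ((d:ℝ)/2) / (Real.Gamma (α/2))^2)
          * betaFn ((d:ℝ)/2 - α/2) (α/2)
          * ‖y‖ ^ (α - (d:ℝ))
          * (1 - regIncBeta (‖y‖^2) ((d:ℝ)/2 - α/2) (α/2))))
      = regIncBeta (R^2) ((d:ℝ)/2) (α/2)
        + R ^ α * (betaFn ((d:ℝ)/2 - α/2) (α/2) / betaFn ((d:ℝ)/2) (α/2))
            * (1 - regIncBeta (R^2) ((d:ℝ)/2 - α/2) (α/2)) := by
  have hα0 := hα.1
  have hd2 : (2 : ℝ) ≤ d := by exact_mod_cast hd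
  have hb : 0 < α / 2 := half_pos hα0
  have ha : 0 < (d : ℝ) / 2 - α / 2 := by linarith [hα.2]
  rw [setIntegral_ball_fun_norm (by omega) hR.1.le (fun r => (kappa d α)⁻¹
    * ((2:ℝ) ^ (-α) * Real.pi ^ (-(d:ℝ)/2)
          * (Real.Gamma ((d:ℝ)/2) / (Real.Gamma (α/2))^2)
          * betaFn ((d:ℝ)/2 - α/2) (α/2)
          * r ^ (α - (d:ℝ))
          * (1 - regIncBeta (r^2) ((d:ℝ)/2 - α/2) (α/2))))]
  have hint := integral_rpow_mul_one_sub_regIncBeta ha hb hb hR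
  rw [mul_div_cancel₀ α two_ne_zero, sub_add_cancel] at hint
  have hfun : ∫ r in (0 : ℝ)..R, r ^ (d - 1) * ((kappa d α)⁻¹
        * ((2:ℝ) ^ (-α) * Real.pi ^ (-(d:ℝ)/2)
          * (Real.Gamma ((d:ℝ)/2) / (Real.Gamma (α/2))^2)
          * betaFn ((d:ℝ)/2 - α/2) (α/2)
          * r ^ (α - (d:ℝ))
          * (1 - regIncBeta (r^2) ((d:ℝ)/2 - α/2) (α/2))))
      = ∫ r in (0 : ℝ)..R, (kappa d α)⁻¹
        * ((2:ℝ) ^ (-α) * Real.pi ^ (-(d:ℝ)/2)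
          * (Real.Gamma ((d:ℝ)/2) / (Real.Gamma (α/2))^2)
          * betaFn ((d:ℝ)/2 - α/2) (α/2)) / α
          * (α * r ^ (α - 1) * (1 - regIncBeta (r^2) ((d:ℝ)/2 - α/2) (α/2))) := by
    refine intervalIntegral.integral_congr_ae (Filter.Eventually.of_forall fun r hr => ?_)
    rw [Set.uIoc_of_le hR.1.le] at hr
    have hp : r ^ (α - 1) = r ^ (d - 1) * r ^ (α - (d : ℝ)) := by
      rw [← Real.rpow_natCast r (d - 1), ← Real.rpow_add hr.1, Nat.cast_sub (by omega)]
      congr 1; push_cast; ring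
    rw [hp]
    field_simp
  rw [hfun, intervalIntegral.integral_const_mul, hint]
  have hB := (betaFn_pos ha hb).ne'
  have hB' := (betaFn_pos (show 0 < (d : ℝ) / 2 by linarith) hb).ne'
  have hc : 2 * π ^ ((d : ℝ) / 2) / Real.Gamma ((d : ℝ) / 2) * ((kappa d α)⁻¹
        * ((2:ℝ) ^ (-α) * Real.pi ^ (-(d:ℝ)/2)
          * (Real.Gamma ((d:ℝ)/2) / (Real.Gamma (α/2))^2)
          * betaFn ((d:ℝ)/2 - α/2) (α/2)) / α)
      = betaFn ((d:ℝ)/2 - α/2) (α/2) / betaFn ((d:ℝ)/2) (α/2) := by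
    generalize betaFn ((d:ℝ)/2 - α/2) (α/2) = B
    have h1 := (Real.Gamma_pos_of_pos hb).ne'
    have h2 := (Real.Gamma_pos_of_pos (show 0 < (d : ℝ) / 2 by linarith)).ne'
    have h3 := (Real.Gamma_pos_of_pos (show 0 < (d : ℝ) / 2 + α / 2 by linarith)).ne'
    have h4 : (0 : ℝ) < 2 ^ α := by positivity
    have h5 : 0 < π ^ ((d : ℝ) / 2) := by positivity
    rw [kappa, betaFn, neg_div, Real.rpow_neg pi_pos.le, Real.rpow_neg two_pos.le,
      Real.rpow_sub two_pos, Real.rpow_one]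
    field_simp
  rw [← mul_assoc, hc]
  generalize betaFn ((d:ℝ)/2 - α/2) (α/2) = B at hB ⊢
  generalize betaFn ((d:ℝ)/2) (α/2) = B' at hB' ⊢
  field_simp
  ring
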